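/- The ternary sum x(2x+1) + y(3y+1) + z(5z+1) is universal; that is, for every non negative integer n, the equation x(2x+1) + y(3y+1) + z(5z+1) = n has an integer solution x, y, z. -/

import Mathlib

/-- A positive definite ternary quadratic form `a x² + b y² + c z² + r y z + s x z + t x y` of
half-discriminant `9` represents only numbers represented by `3 m² + y² + y z + z²`. -/
lemma exists_of_disc_eq_nine {a b c r s t N : ℤ} (ha : 0 < a) (hD : 0 < 4 * a * b - t ^ 2)
    (hdisc : 4 * a * b * c + r * s * t - a * r ^ 2 - b * s ^ 2 - c * t ^ 2 = 9)
    (hN : ∃ x y z, N = a * x ^ 2 + b * y ^ 2 + c * z ^ 2 + r * y * z + s * x * z + t * x * y) :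
    ∃ m y z : ℤ, N = 3 * m ^ 2 + y ^ 2 + y * z + z ^ 2 := by
  induction hn : (a + (4 * a * b - t ^ 2)).toNat using Nat.strong_induction_on
    generalizing a b c r s t with
  | _ n ih =>
  obtain ⟨k, hk⟩ : ∃ k, -a ≤ t - 2 * a * k ∧ t - 2 * a * k < a := by
    refine ⟨(t + a) / (2 * a), ?_⟩
    have h1 := Int.emod_nonneg (t + a) (by omega : 2 * a ≠ 0)
    have h2 := Int.emod_lt_of_pos (t + a) (by omega : 0 < 2 * a)
    have h3 := Int.emod_add_mul_ediv (t + a) (2 * a)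
    constructor <;> linarith
  obtain ⟨x, y, z, hN⟩ := hN
  have hD' : 4 * a * (b + a * k ^ 2 - t * k) - (t - 2 * a * k) ^ 2 = 4 * a * b - t ^ 2 := by ring
  have hdisc' : 4 * a * (b + a * k ^ 2 - t * k) * c + (r - s * k) * s * (t - 2 * a * k) -
      a * (r - s * k) ^ 2 - (b + a * k ^ 2 - t * k) * s ^ 2 - c * (t - 2 * a * k) ^ 2 = 9 := by
    rw [← hdisc]; ring
  have hN' : ∃ x y z, N = a * x ^ 2 + (b + a * k ^ 2 - t * k) * y ^ 2 + c * z ^ 2 +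
      (r - s * k) * y * z + s * x * z + (t - 2 * a * k) * x * y :=
    ⟨x + k * y, y, z, by rw [hN]; ring⟩
  rw [← hD'] at hD hn
  generalize b + a * k ^ 2 - t * k = b at *
  generalize r - s * k = r at *
  generalize t - 2 * a * k = t at *
  clear hN hdisc hD' x y z
  obtain ⟨x, y, z, hN⟩ := hN'
  have hb : 0 < b := by nlinarith [sq_nonneg t]
  rcases lt_or_ge b a with hba | hab
  · exact ih _ (by rw [← hn, mul_right_comm 4 b a]; omega) hb
      (by linarith : 0 < 4 * b * a - t ^ 2)
      (c := c) (r := s) (s := r) (by linarith) ⟨y, x, z, by rw [hN]; ring⟩ rfl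
  have hDa : 3 * a ^ 2 ≤ 4 * a * b - t ^ 2 := by nlinarith
  set D := 4 * a * b - t ^ 2 with hDdef
  obtain ⟨k, hk1, hk2⟩ : ∃ k, -D ≤ 2 * (2 * a * r - s * t - k * D) ∧
      2 * (2 * a * r - s * t - k * D) ≤ D := by
    refine ⟨(2 * (2 * a * r - s * t) + D) / (2 * D), ?_⟩
    have h1 := Int.emod_nonneg (2 * (2 * a * r - s * t) + D) (by omega : 2 * D ≠ 0)
    have h2 := Int.emod_lt_of_pos (2 * (2 * a * r - s * t) + D) (by omega : 0 < 2 * D)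
    have h3 := Int.emod_add_mul_ediv (2 * (2 * a * r - s * t) + D) (2 * D)
    constructor <;> linarith
  have hm : 2 * a * (r - 2 * b * k) - (s - t * k) * t = 2 * a * r - s * t - k * D := by
    rw [hDdef]; ring
  have hdisc : 4 * a * b * (c + b * k ^ 2 - r * k) + (r - 2 * b * k) * (s - t * k) * t -
      a * (r - 2 * b * k) ^ 2 - b * (s - t * k) ^ 2 - (c + b * k ^ 2 - r * k) * t ^ 2 = 9 := by
    rw [← hdisc']; ring
  have hN' : ∃ x y z, N = a * x ^ 2 + b * y ^ 2 + (c + b * k ^ 2 - r * k) * z ^ 2 +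
      (r - 2 * b * k) * y * z + (s - t * k) * x * z + t * x * y :=
    ⟨x, y + k * z, z, by rw [hN]; ring⟩
  rw [← hm] at hk1 hk2
  generalize c + b * k ^ 2 - r * k = c at *
  generalize r - 2 * b * k = r at *
  generalize s - t * k = s at *
  clear hN hdisc' hm x y z
  obtain ⟨x, y, z, hN⟩ := hN'
  have hmm : D * (4 * a * c - s ^ 2) = 36 * a + (2 * a * r - s * t) ^ 2 := by
    rw [hDdef]; linear_combination 4 * a * hdisc
  have hD2 : 0 < 4 * a * c - s ^ 2 := by
    refine pos_of_mul_pos_right (a := D) ?_ hD.le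
    rw [hmm]; positivity
  rcases lt_or_ge (4 * a * c - s ^ 2) D with hlt | hge
  · exact ih _ (by omega) ha hD2 (b := c) (c := b) (r := r) (s := t) (by linarith)
      ⟨x, z, y, by rw [hN]; ring⟩ rfl
  have hm4 : 4 * (2 * a * r - s * t) ^ 2 ≤ D ^ 2 := by nlinarith
  have h144 : 3 * D ^ 2 ≤ 144 * a := by nlinarith
  have ha1 : a = 1 := by
    by_contra h
    have h2 : 2 ≤ a := by omega
    have : 9 * a ^ 4 ≤ D ^ 2 := by nlinarith [sq_nonneg a]
    have : 8 ≤ a ^ 3 := by nlinarith [mul_self_nonneg (a - 2)]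
    nlinarith
  subst ha1
  have hD6 : D ≤ 6 := by nlinarith
  obtain ⟨k, hk3⟩ : ∃ k, s - 2 * k = 0 ∨ s - 2 * k = 1 := ⟨s / 2, by omega⟩
  have hN' : ∃ x y z, N = x ^ 2 + b * y ^ 2 + (c + k ^ 2 - s * k) * z ^ 2 +
      (r - t * k) * y * z + (s - 2 * k) * x * z + t * x * y :=
    ⟨x + k * z, y, z, by rw [hN]; ring⟩
  have hm : 2 * (r - t * k) - (s - 2 * k) * t = 2 * 1 * r - s * t := by ring
  have hc : 4 * (c + k ^ 2 - s * k) - (s - 2 * k) ^ 2 = 4 * 1 * c - s ^ 2 := by ring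
  clear hD2 hge
  rw [← hm] at hmm hk1 hk2
  rw [← hc] at hmm
  generalize c + k ^ 2 - s * k = c at *
  generalize r - t * k = r at *
  generalize s - 2 * k = s at *
  clear hN hm hc x y z hdisc ih hm4 h144
  obtain ⟨x, y, z, hN⟩ := hN'
  have ht : t = 0 ∨ t = -1 := by omega
  rcases ht with rfl | rfl
  · have hb1 : b = 1 := by omega
    subst hb1
    have : D = 4 := by omega
    rw [this] at hmm hk1 hk2
    have : r = -1 ∨ r = 0 ∨ r = 1 := by omega
    rcases hk3 with h | h <;> rw [h] at hmm <;> rcases this with rfl | rfl | rfl <;>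
      norm_num at hmm <;> omega
  · have hb1 : b = 1 := by omega
    subst hb1
    have : D = 3 := by omega
    rw [this] at hmm hk1 hk2
    rcases hk3 with h | h <;> rw [h] at hmm hN
    · have : r = 0 := by omega
      subst this
      have : c = 3 := by norm_num at hmm; omega
      subst this
      exact ⟨z, x, -y, by rw [hN]; ring⟩
    · have : r = -1 ∨ r = 0 := by omega
      rcases this with rfl | rfl <;> norm_num at hmm <;> omega

open scoped NumberTheorySymbols in
lemma jacobiSym_neg_three {n : ℕ} (hn : Odd n) : J(-3 | n) = J(n | 3) := by
  rw [show (-3 : ℤ) = -((3 : ℕ) : ℤ) by norm_num, jacobiSym.neg _ hn]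
  rcases Nat.odd_mod_four_iff.1 (Nat.odd_iff.1 hn) with h | h
  · rw [ZMod.χ₄_nat_one_mod_four h, one_mul,
      jacobiSym.quadratic_reciprocity_one_mod_four' (by decide) h]
  · rw [ZMod.χ₄_nat_three_mod_four h,
      jacobiSym.quadratic_reciprocity_three_mod_four (by norm_num) h]
    ring

open scoped NumberTheorySymbols in
lemma jacobiSym_neg_three_mul {p E : ℕ} (hp : p % 2 = 1) (hE : E % 8 = 5)
    (h3 : (E + p) % 3 = 0) (hE3 : E % 3 ≠ 0) (hpE : E ∣ 8 * p + 3) : J(-3 * E | p) = 1 := by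
  have hpo : Odd p := Nat.odd_iff.2 hp
  have hEo : Odd E := Nat.odd_iff.2 (by omega)
  have h8 : J(8 | E) = -1 := by
    rw [show (8 : ℤ) = 2 ^ 3 by norm_num, jacobiSym.pow_left, jacobiSym.at_two hEo,
      ZMod.χ₈_nat_eq_if_mod_eight]
    simp [hE]
    omega
  have h1 : J(8 * p | E) = J(-3 | E) := by
    apply jacobiSym.mod_left'
    refine Int.ModEq.symm (Int.modEq_iff_dvd.2 ?_)
    obtain ⟨q, hq⟩ := hpE
    exact ⟨q, by have : (8 * p + 3 : ℤ) = E * q := by exact_mod_cast hq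
                 linarith⟩
  rw [jacobiSym.mul_left, jacobiSym_neg_three hEo, h8] at h1
  rw [jacobiSym.mul_left, jacobiSym_neg_three hpo,
    jacobiSym.quadratic_reciprocity_one_mod_four (by omega) hpo]
  rcases (by omega : E % 3 = 1 ∧ p % 3 = 2 ∨ E % 3 = 2 ∧ p % 3 = 1) with h | h
  · have hE1 : J(E | 3) = 1 := by
      rw [jacobiSym.mod_left, show ((E : ℤ) % (3 : ℕ)) = 1 by omega]; norm_num
    have hp1 : J(p | 3) = -1 := by
      rw [jacobiSym.mod_left, show ((p : ℤ) % (3 : ℕ)) = 2 by omega]; norm_num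
    rw [hE1] at h1; rw [hp1]; linarith
  · have hE1 : J(E | 3) = -1 := by
      rw [jacobiSym.mod_left, show ((E : ℤ) % (3 : ℕ)) = 2 by omega]; norm_num
    have hp1 : J(p | 3) = 1 := by
      rw [jacobiSym.mod_left, show ((p : ℤ) % (3 : ℕ)) = 1 by omega]; norm_num
    rw [hE1] at h1; rw [hp1]; linarith

lemma exists_dvd_add_three_mul_sq {p E : ℕ} (hp : p.Prime) (hp3 : 3 < p) (hE : E % 8 = 5)
    (h3 : (E + p) % 3 = 0) (hE3 : E % 3 ≠ 0) (hpE : E ∣ 8 * p + 3) :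
    ∃ t : ℤ, (32 * p : ℤ) ∣ E + 3 * t ^ 2 := by
  have := Fact.mk hp
  have hp2 : p % 2 = 1 := hp.eq_two_or_odd.resolve_left (by omega)
  have hJ := jacobiSym_neg_three_mul hp2 hE h3 hE3 hpE
  rw [← jacobiSym.legendreSym.to_jacobiSym] at hJ
  have hsq : IsSquare ((-3 * E : ℤ) : ZMod p) := by
    refine (legendreSym.eq_one_iff p fun h ↦ ?_).1 hJ
    rw [(legendreSym.eq_zero_iff p _).2 h] at hJ
    norm_num at hJ
  obtain ⟨y, hy⟩ := hsq
  have h30 : (3 : ZMod p) ≠ 0 := by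
    intro h
    have := (ZMod.natCast_eq_zero_iff 3 p).1 (by exact_mod_cast h)
    exact absurd (Nat.le_of_dvd (by norm_num) this) (by omega)
  obtain ⟨w, hw⟩ := ZMod.intCast_surjective (y / 3)
  have hpw : (p : ℤ) ∣ E + 3 * w ^ 2 := by
    rw [← ZMod.intCast_zmod_eq_zero_iff_dvd]
    push_cast at hy ⊢
    rw [hw]
    field_simp
    linear_combination -hy
  obtain ⟨t, ht⟩ : ∃ t : ℤ, (32 : ℤ) ∣ E + 3 * t ^ 2 := by
    rcases (by omega : E % 32 = 5 ∨ E % 32 = 13 ∨ E % 32 = 21 ∨ E % 32 = 29) with h | h | h | h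
    · exact ⟨3, by omega⟩
    · exact ⟨7, by omega⟩
    · exact ⟨5, by omega⟩
    · exact ⟨1, by omega⟩
  have hcop : IsCoprime (32 : ℤ) p := by
    rw [show (32 : ℤ) = 2 ^ 5 by norm_num]
    exact IsCoprime.pow_left ((Int.isCoprime_iff_gcd_eq_one).2
      ((Nat.coprime_primes Nat.prime_two hp).2 (by omega)))
  obtain ⟨α, β, h⟩ := id hcop
  refine ⟨w * (α * 32) + t * (β * p), hcop.mul_dvd ?_ ?_⟩
  · have : w * (α * 32) + t * (β * p) = t + 32 * ((w - t) * α) := by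
      linear_combination t * h
    rw [this]
    obtain ⟨q, hq⟩ := ht
    exact ⟨q + 6 * t * ((w - t) * α) + 96 * ((w - t) * α) ^ 2, by linear_combination hq⟩
  · have : w * (α * 32) + t * (β * p) = w + p * ((t - w) * β) := by
      linear_combination w * h
    rw [this]
    obtain ⟨q, hq⟩ := hpw
    exact ⟨q + 6 * w * ((t - w) * β) + 3 * p * ((t - w) * β) ^ 2, by linear_combination hq⟩

/-- Dirichlet's theorem provides a form of half-discriminant `9` representing `N`. -/
lemma exists_eq_three_mul_sq_add {N : ℤ} (hN : 0 < N) (h8 : N % 8 = 7) (h3 : N % 3 = 1) :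
    ∃ m y z : ℤ, N = 3 * m ^ 2 + y ^ 2 + y * z + z ^ 2 := by
  lift N to ℕ using hN.le
  obtain ⟨k, hk⟩ : ∃ k : ℕ, N = 8 * k + 7 := ⟨N / 8, by omega⟩
  have hcop : IsCoprime (-3 * (k + 1) : ℤ) N := by
    refine IsCoprime.mul_left ?_ ⟨8, -1, by rw [hk]; push_cast; ring⟩
    obtain ⟨l, hl⟩ : ∃ l : ℕ, N = 3 * l + 1 := ⟨N / 3, by omega⟩
    exact ⟨l, 1, by rw [hl]; push_cast; ring⟩
  obtain ⟨p, hp3, hp, hpN⟩ := Nat.forall_exists_prime_gt_and_zmodEq 3 (by omega : N ≠ 0) hcop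
  obtain ⟨E, hE⟩ : N ∣ 8 * p + 3 := by
    obtain ⟨q, hq⟩ := Int.modEq_iff_dvd.1 hpN
    have : (N : ℤ) ∣ ((8 * p + 3 : ℕ) : ℤ) :=
      ⟨-3 - 8 * q, by push_cast; rw [mul_sub, mul_left_comm, ← hq, hk]; push_cast; ring⟩
    exact_mod_cast this
  have hp3' : p % 3 ≠ 0 := fun h ↦ by
    have := (Nat.prime_dvd_prime_iff_eq Nat.prime_three hp).1 (Nat.dvd_of_mod_eq_zero h)
    omega
  obtain ⟨l, hl⟩ : ∃ l : ℕ, N = 3 * l + 1 := ⟨N / 3, by omega⟩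
  have hE3 : E + 3 * (l * E) = 8 * p + 3 := by rw [hE, hl]; ring
  have hE8 : 7 * E + 8 * (k * E) = 8 * p + 3 := by rw [hE, hk]; ring
  obtain ⟨t, b, hb⟩ := exists_dvd_add_three_mul_sq hp hp3 (by omega) (by omega) (by omega)
    (Dvd.intro_left N hE.symm)
  have hE' : (8 * p + 3 : ℤ) = N * E := by exact_mod_cast hE
  refine exists_of_disc_eq_nine (a := 24 * p) (b := b) (c := N) (r := 1) (s := 0) (t := 3 * t)
    (by omega) ?_ ?_ ⟨0, 0, 1, by ring⟩
  · have : 4 * (24 * p) * b - (3 * t) ^ 2 = 3 * (E : ℤ) := by linear_combination -3 * hb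
    omega
  · linear_combination -3 * (N : ℤ) * hb - 3 * hE'

/-- `N` is represented by the ternary form `15 x² + 16 (u² + u v + 4 v²)`. -/
def IsGood (N : ℤ) : Prop :=
  ∃ x u v : ℤ, N = 15 * x ^ 2 + 16 * (u ^ 2 + u * v + 4 * v ^ 2)

lemma isGood_of_modEq {N s a b : ℤ} (h : N = s ^ 2 + 15 * a ^ 2 + 15 * b ^ 2)
    (hsb : (s - b) % 8 = 0) : IsGood N := by
  obtain ⟨k, hk⟩ : ∃ k, s = b + 8 * k := ⟨(s - b) / 8, by omega⟩
  exact ⟨a, b + k, -k, by subst hk; rw [h]; ring⟩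

/-- A representation of `N` by `s² + 15 a² + 15 b²` by odd numbers, with signs normalised,
to which `isGood_of_modEq` does not apply. -/
structure IsBad (N s a b : ℤ) : Prop where
  eq : N = s ^ 2 + 15 * a ^ 2 + 15 * b ^ 2
  odd : s % 2 = 1
  left : (a - s - 4) % 8 = 0
  right : (b - s - 4) % 8 = 0

lemma IsBad.swap {N s a b : ℤ} (h : IsBad N s a b) : IsBad N s b a :=
  ⟨by rw [h.eq]; ring, h.odd, h.right, h.left⟩

lemma exists_sign_of_not_isGood {N s a b : ℤ} (hN : ¬ IsGood N)
    (h : N = s ^ 2 + 15 * a ^ 2 + 15 * b ^ 2) (hs : s % 2 = 1) (hb : b % 2 = 1) :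
    (b - s - 4) % 8 = 0 ∨ (-b - s - 4) % 8 = 0 := by
  have h1 : (s - b) % 8 ≠ 0 := fun h' ↦ hN (isGood_of_modEq h h')
  have h2 : (s - -b) % 8 ≠ 0 := fun h' ↦
    hN (isGood_of_modEq (a := a) (b := -b) (by rw [h]; ring) h')
  omega

lemma IsBad.of_odd {N s a b : ℤ} (hN : ¬ IsGood N)
    (h : N = s ^ 2 + 15 * a ^ 2 + 15 * b ^ 2) (hs : s % 2 = 1) (ha : a % 2 = 1)
    (hb : b % 2 = 1) :
    ∃ a' b', (a' = a ∨ a' = -a) ∧ (b' = b ∨ b' = -b) ∧ IsBad N s a' b' := by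
  have h' : N = s ^ 2 + 15 * b ^ 2 + 15 * a ^ 2 := by rw [h]; ring
  rcases exists_sign_of_not_isGood hN h hs hb with h1 | h1 <;>
    rcases exists_sign_of_not_isGood hN h' hs ha with h2 | h2
  · exact ⟨a, b, by simp, by simp, h, hs, h2, h1⟩
  · exact ⟨-a, b, by simp, by simp, by rw [h]; ring, hs, h2, h1⟩
  · exact ⟨a, -b, by simp, by simp, by rw [h]; ring, hs, h2, h1⟩
  · exact ⟨-a, -b, by simp, by simp, by rw [h]; ring, hs, h2, h1⟩

lemma IsBad.isGood_of_dvd_sub {N s a b : ℤ} (h : IsBad N s a b)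
    (h5 : (s - 3 * a - b) % 5 = 0) : IsGood N := by
  obtain ⟨-, ho, hl, hr⟩ := id h
  obtain ⟨k, hk⟩ : ∃ k, s + 7 * a - 6 * b = 10 * k := ⟨(s + 7 * a - 6 * b) / 10, by omega⟩
  obtain ⟨l, hl'⟩ : ∃ l, s + 3 * a + 6 * b = 2 * l := ⟨(s + 3 * a + 6 * b) / 2, by omega⟩
  obtain ⟨m, hm⟩ : ∃ m, s - 3 * a - b = 5 * m := ⟨(s - 3 * a - b) / 5, by omega⟩
  refine isGood_of_modEq (s := l) (a := m) (b := k) ?_ (by omega)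
  rw [h.eq]
  have e1 : (l : ℚ) = (s + 3 * a + 6 * b) / 2 := by
    rw [eq_div_iff (by norm_num)]; exact_mod_cast (by linarith)
  have e2 : (m : ℚ) = (s - 3 * a - b) / 5 := by
    rw [eq_div_iff (by norm_num)]; exact_mod_cast (by linarith)
  have e3 : (k : ℚ) = (s + 7 * a - 6 * b) / 10 := by
    rw [eq_div_iff (by norm_num)]; exact_mod_cast (by linarith)
  have : (s ^ 2 + 15 * a ^ 2 + 15 * b ^ 2 : ℚ) = l ^ 2 + 15 * m ^ 2 + 15 * k ^ 2 := by
    rw [e1, e2, e3]; ring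
  exact_mod_cast this

lemma IsBad.isGood_of_dvd_add {N s a b : ℤ} (h : IsBad N s a b)
    (h5 : (s + a + 3 * b) % 5 = 0) : IsGood N := by
  obtain ⟨-, ho, hl, hr⟩ := id h
  obtain ⟨k, hk⟩ : ∃ k, s - 9 * a - 2 * b = 10 * k := ⟨(s - 9 * a - 2 * b) / 10, by omega⟩
  obtain ⟨l, hl'⟩ : ∃ l, s + 3 * a - 6 * b = 2 * l := ⟨(s + 3 * a - 6 * b) / 2, by omega⟩
  obtain ⟨m, hm⟩ : ∃ m, s + a + 3 * b = 5 * m := ⟨(s + a + 3 * b) / 5, by omega⟩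
  refine isGood_of_modEq (s := l) (a := m) (b := k) ?_ (by omega)
  rw [h.eq]
  have e1 : (l : ℚ) = (s + 3 * a - 6 * b) / 2 := by
    rw [eq_div_iff (by norm_num)]; exact_mod_cast (by linarith)
  have e2 : (m : ℚ) = (s + a + 3 * b) / 5 := by
    rw [eq_div_iff (by norm_num)]; exact_mod_cast (by linarith)
  have e3 : (k : ℚ) = (s - 9 * a - 2 * b) / 10 := by
    rw [eq_div_iff (by norm_num)]; exact_mod_cast (by linarith)
  have : (s ^ 2 + 15 * a ^ 2 + 15 * b ^ 2 : ℚ) = l ^ 2 + 15 * m ^ 2 + 15 * k ^ 2 := by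
    rw [e1, e2, e3]; ring
  exact_mod_cast this

lemma IsBad.isGood_of_dvd {N s a b : ℤ} (h : IsBad N s a b)
    (h5 : (a - 3 * b) % 5 = 0) : IsGood N := by
  obtain ⟨-, ho, hl, hr⟩ := id h
  obtain ⟨k, hk⟩ : ∃ k, 3 * a - 4 * b = 5 * k := ⟨(3 * a - 4 * b) / 5, by omega⟩
  obtain ⟨m, hm⟩ : ∃ m, 4 * a + 3 * b = 5 * m := ⟨(4 * a + 3 * b) / 5, by omega⟩
  refine isGood_of_modEq (s := s) (a := m) (b := -k) ?_ (by omega)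
  rw [h.eq]
  have : 25 * (a ^ 2 + b ^ 2) = 25 * (m ^ 2 + k ^ 2) := by
    linear_combination (3 * a - 4 * b + 5 * k) * hk + (4 * a + 3 * b + 5 * m) * hm
  linear_combination (15 / 25 : ℤ) * this + 15 * (by linarith : a ^ 2 + b ^ 2 = m ^ 2 + k ^ 2)

lemma intCast_zmod_five_ne_zero {x : ℤ} (h : ¬ x % 5 = 0) : (x : ZMod 5) ≠ 0 := fun h' ↦
  h (Int.emod_eq_zero_of_dvd ((ZMod.intCast_zmod_eq_zero_iff_dvd x 5).1 h'))

lemma IsBad.sq_eq_one {N s a b : ℤ} (h5 : N % 5 = 1) (h : IsBad N s a b) :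
    (s : ZMod 5) ^ 2 = 1 := by
  have : (((s ^ 2 - 1 : ℤ)) : ZMod 5) = 0 :=
    (ZMod.intCast_zmod_eq_zero_iff_dvd _ 5).2 (by have := h.eq; omega)
  push_cast at this
  linear_combination this

/-- The residue classes modulo `5` of a bad representation on which no isometry with
denominator `5` leads to a good one. -/
lemma IsBad.mod_five {N s a b : ℤ} (hN : ¬ IsGood N) (h5 : N % 5 = 1) (h : IsBad N s a b) :
    ((a : ZMod 5) = 3 * s ∧ (b : ZMod 5) = 3 * s) ∨ ((a : ZMod 5) = 2 * s ∧ (b : ZMod 5) = 2 * s) ∨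
      ((a : ZMod 5) = s ∧ (b : ZMod 5) = -s) ∨ ((a : ZMod 5) = -s ∧ (b : ZMod 5) = s) := by
  have n1 := intCast_zmod_five_ne_zero (mt h.isGood_of_dvd_sub hN)
  have n2 := intCast_zmod_five_ne_zero (mt h.isGood_of_dvd_add hN)
  have n3 := intCast_zmod_five_ne_zero (mt h.isGood_of_dvd hN)
  have n4 := intCast_zmod_five_ne_zero (mt h.swap.isGood_of_dvd_sub hN)
  have n5 := intCast_zmod_five_ne_zero (mt h.swap.isGood_of_dvd_add hN)
  have n6 := intCast_zmod_five_ne_zero (mt h.swap.isGood_of_dvd hN)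
  have hs := h.sq_eq_one h5
  push_cast at n1 n2 n3 n4 n5 n6
  generalize (s : ZMod 5) = s at *
  generalize (a : ZMod 5) = a at *
  generalize (b : ZMod 5) = b at *
  clear h
  revert s a b
  decide

/-- One step of an isometry of infinite order, the rotation
`(s, a, b) ↦ (-(s + 15 b) / 4, (b - s) / 4, a)` with axis spanned by `(-3, 1, 1)`, up to signs. -/
lemma IsBad.exists_rotate {N s a b : ℤ} (hN : ¬ IsGood N) (h : IsBad N s a b) :
    ∃ s' a' a₁ b₁, 4 * s' = -s - 15 * b ∧ 4 * a' = b - s ∧ (a₁ = a' ∨ a₁ = -a') ∧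
      (b₁ = a ∨ b₁ = -a) ∧ IsBad N s' a₁ b₁ := by
  obtain ⟨he, ho, hl, hr⟩ := id h
  obtain ⟨s', hs'⟩ : ∃ s', 4 * s' = -s - 15 * b := ⟨(-s - 15 * b) / 4, by omega⟩
  obtain ⟨a', ha'⟩ : ∃ a', 4 * a' = b - s := ⟨(b - s) / 4, by omega⟩
  have : N = s' ^ 2 + 15 * a' ^ 2 + 15 * a ^ 2 := by
    have : 16 * (s ^ 2 + 15 * b ^ 2) = 16 * (s' ^ 2 + 15 * a' ^ 2) := by
      linear_combination (s + 15 * b - 4 * s') * hs' - 15 * (b - s + 4 * a') * ha'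
    linarith
  obtain ⟨a₁, b₁, h1, h2, h3⟩ :=
    IsBad.of_odd hN this (by omega) (by omega) (by omega)
  exact ⟨s', a', a₁, b₁, hs', ha', h1, h2, h3⟩

lemma IsBad.rotate {N s a b : ℤ} (hN : ¬ IsGood N) (h5 : N % 5 = 1) (h : IsBad N s a b) :
    ∃ s' a', 4 * s' = -s - 15 * b ∧ 4 * a' = b - s ∧ IsBad N s' a' a := by
  have key : ∀ {s a b : ℤ}, IsBad N s a b → (a : ZMod 5) = 3 * s ∧ (b : ZMod 5) = 3 * s := by
    intro s a b h
    have hab := h.mod_five hN h5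
    have hs := h.sq_eq_one h5
    obtain ⟨s', a', a₁, b₁, h1, h2, h3, h4, h'⟩ := h.exists_rotate hN
    have hab' := h'.mod_five hN h5
    have hss : (s' : ZMod 5) = s := by
      have := congrArg (Int.cast (R := ZMod 5)) h1
      push_cast at this
      linear_combination -this + (s' + 3 * b) * (by decide : (5 : ZMod 5) = 0)
    have haa : (a' : ZMod 5) = s - b := by
      have := congrArg (Int.cast (R := ZMod 5)) h2
      push_cast at this
      linear_combination -this + a' * (by decide : (5 : ZMod 5) = 0)
    have h3' : (a₁ : ZMod 5) = s - b ∨ (a₁ : ZMod 5) = -(s - b) := by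
      rw [← haa]; exact_mod_cast h3.imp (congrArg Int.cast) (congrArg Int.cast)
    have h4' : (b₁ : ZMod 5) = a ∨ (b₁ : ZMod 5) = -a := by
      exact_mod_cast h4.imp (congrArg (Int.cast (R := ZMod 5))) (congrArg (Int.cast (R := ZMod 5)))
    rw [hss] at hab'
    clear h h' h1 h2 h3 h4 hss haa
    generalize (s : ZMod 5) = s at *
    generalize (a : ZMod 5) = a at *
    generalize (b : ZMod 5) = b at *
    generalize (a₁ : ZMod 5) = a₁ at *
    generalize (b₁ : ZMod 5) = b₁ at *
    rcases h3' with h3' | h3' <;> rcases h4' with h4' | h4' <;> rw [h3', h4'] at hab' <;>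
      clear h3' h4' <;> revert s a b <;> decide
  obtain ⟨ha, hb⟩ := key h
  have hs := h.sq_eq_one h5
  obtain ⟨s', a', a₁, b₁, h1, h2, h3, h4, h'⟩ := h.exists_rotate hN
  obtain ⟨ha', hb'⟩ := key h'
  have e1 := congrArg (Int.cast (R := ZMod 5)) h1
  have e2 := congrArg (Int.cast (R := ZMod 5)) h2
  push_cast at e1 e2
  have h3' : a₁ = a' := by
    refine h3.resolve_right fun h3 ↦ ?_
    rw [h3] at ha'
    push_cast at ha'
    generalize (s : ZMod 5) = s at *
    generalize (s' : ZMod 5) = s' at *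
    generalize (b : ZMod 5) = b at *
    generalize (a' : ZMod 5) = a' at *
    clear h h' h1 h2 h3 h4 hb' ha
    revert s s' a' b
    decide
  have h4' : b₁ = a := by
    refine h4.resolve_right fun h4 ↦ ?_
    rw [h4] at hb'
    push_cast at hb'
    generalize (s : ZMod 5) = s at *
    generalize (s' : ZMod 5) = s' at *
    generalize (b : ZMod 5) = b at *
    generalize (a : ZMod 5) = a at *
    clear h h' h1 h2 h3 h4 ha' h3' e2
    revert s s' a b
    decide
  exact ⟨s', a', h1, h2, h3' ▸ h4' ▸ h'⟩

/-- If `N` were not good, the rotation could be iterated for ever on a bad representation. Being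
of infinite order while preserving an integral vector, it would have to fix that vector, which
then lies on the axis. This is impossible unless `N = 39 x²`. -/
lemma IsBad.isGood {N s a b : ℤ} (h3 : N % 3 = 1) (h5 : N % 5 = 1) (h : IsBad N s a b) :
    IsGood N := by
  by_contra hN
  let S := {v : ℤ × ℤ × ℤ // IsBad N v.1 v.2.1 v.2.2}
  have step : ∀ v : S, ∃ w : S, 4 * w.1.1 = -v.1.1 - 15 * v.1.2.2 ∧
      4 * w.1.2.1 = v.1.2.2 - v.1.1 ∧ w.1.2.2 = v.1.2.1 := by
    rintro ⟨⟨s, a, b⟩, hv⟩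
    obtain ⟨s', a', h1, h2, h'⟩ := hv.rotate hN h5
    exact ⟨⟨(s', a', a), h'⟩, h1, h2, rfl⟩
  choose f hf1 hf2 hf3 using step
  let F : ℕ → S := fun k ↦ f^[k] ⟨(s, a, b), h⟩
  have hF : ∀ k, F (k + 1) = f (F k) := fun k ↦ Function.iterate_succ_apply' f k _
  let x : ℕ → ℤ := fun k ↦ (F k).1.2.1
  have hb : ∀ k, (F (k + 1)).1.2.2 = x k := fun k ↦ by rw [hF, hf3]
  have hs : ∀ k, (F (k + 1)).1.1 = x k - 4 * x (k + 2) := fun k ↦ by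
    have := hf2 (F (k + 1))
    rw [← hF, hb] at this
    simp only [x] at this ⊢
    linarith
  have hrec : ∀ k, 4 * (x (k + 3) - x (k + 2)) =
      -5 * (x (k + 2) - x (k + 1)) - 4 * (x (k + 1) - x k) := fun k ↦ by
    have := hf1 (F (k + 1))
    rw [← hF, hs, hs, hb] at this
    linarith
  have hdvd : ∀ j k, j ≤ k → (4 : ℤ) ^ j ∣ x (k + 1) - x k := by
    intro j
    induction j with
    | zero => simp
    | succ j ih =>
      intro k hk
      obtain ⟨k, rfl⟩ : ∃ i, k = i + 1 := ⟨k - 1, by omega⟩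
      have hcop : IsCoprime ((4 : ℤ) ^ (j + 1)) 5 := IsCoprime.pow_left ⟨-1, 1, by norm_num⟩
      refine hcop.dvd_of_dvd_mul_left ?_
      obtain ⟨u, hu⟩ := ih k (by omega)
      obtain ⟨v, hv⟩ := ih (k + 2) (by omega)
      refine ⟨-u - v, ?_⟩
      have := hrec k
      rw [hu, hv] at this
      rw [pow_succ]
      linear_combination this
  have hbound : ∀ k, |x k| ≤ N := fun k ↦ by
    have := (F k).2.eq
    have h2 : x k ^ 2 ≤ N := by
      change (F k).1.2.1 ^ 2 ≤ N
      nlinarith [sq_nonneg (F k).1.1, sq_nonneg (F k).1.2.1, sq_nonneg (F k).1.2.2]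
    refine le_trans ?_ h2
    rw [← sq_abs]
    rcases (abs_nonneg (x k)).eq_or_lt with h0 | h0
    · rw [← h0]; norm_num
    · nlinarith
  obtain ⟨j, hj⟩ : ∃ j : ℕ, 2 * N < 4 ^ j := by
    obtain ⟨j, hj⟩ := pow_unbounded_of_one_lt (2 * N) (by norm_num : (1 : ℤ) < 4)
    exact ⟨j, hj⟩
  have hconst : ∀ k, j ≤ k → x (k + 1) = x k := fun k hk ↦ by
    have h0 := Int.eq_zero_of_abs_lt_dvd (hdvd j k hk) (by
      calc |x (k + 1) - x k| ≤ |x (k + 1)| + |x k| := abs_sub _ _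
        _ ≤ N + N := add_le_add (hbound _) (hbound _)
        _ < 4 ^ j := by linarith)
    linarith
  have := (F (j + 1)).2.eq
  rw [hs, hb, hconst (j + 1) (by omega), hconst j le_rfl] at this
  change N = _ + 15 * x (j + 1) ^ 2 + _ at this
  rw [hconst j le_rfl] at this
  have h39 : N = 3 * (13 * x j ^ 2) := by rw [this]; ring
  omega

lemma isGood_of_odd {N s a b : ℤ} (h3 : N % 3 = 1) (h5 : N % 5 = 1)
    (h : N = s ^ 2 + 15 * a ^ 2 + 15 * b ^ 2) (hs : s % 2 = 1) (ha : a % 2 = 1)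
    (hb : b % 2 = 1) : IsGood N := by
  by_contra hN
  obtain ⟨a', b', -, -, h'⟩ := IsBad.of_odd hN h hs ha hb
  exact hN (h'.isGood h3 h5)

lemma isGood_of_parity {N s a b : ℤ} (h3 : N % 3 = 1) (h5 : N % 5 = 1) (h8 : N % 8 = 7)
    (h : N = s ^ 2 + 15 * a ^ 2 + 15 * b ^ 2) (ha : a % 2 = 1) (hsb : (s - b) % 2 = 0) :
    IsGood N := by
  rcases (by omega : s % 2 = 1 ∨ s % 2 = 0) with hs | hs
  · exact isGood_of_odd h3 h5 h hs ha (by omega)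
  obtain ⟨s, rfl⟩ : ∃ k, s = 2 * k := ⟨s / 2, by omega⟩
  obtain ⟨b, rfl⟩ : ∃ k, b = 2 * k := ⟨b / 2, by omega⟩
  obtain ⟨a', rfl⟩ : ∃ k, a = 2 * k + 1 := ⟨a / 2, by omega⟩
  have h' : N = 4 * (s ^ 2 + 15 * b ^ 2) + 60 * (a' * (a' + 1)) + 15 := by rw [h]; ring
  obtain ⟨q, hq⟩ : ∃ q, a' * (a' + 1) = 2 * q := (Int.even_mul_succ_self a').two_dvd
  have : (s ^ 2 + 15 * b ^ 2) % 2 = 0 := by omega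
  have : (s - b) % 2 = 0 := by
    rcases (by omega : s % 2 = 0 ∨ s % 2 = 1) with e | e <;>
    rcases (by omega : b % 2 = 0 ∨ b % 2 = 1) with f | f <;>
    simp [pow_two, Int.add_emod, Int.mul_emod, e, f] at this <;> omega
  obtain ⟨w, hw⟩ : ∃ w, s = b + 2 * w := ⟨(s - b) / 2, by omega⟩
  exact ⟨2 * a' + 1, w, b, by rw [h, hw]; ring⟩

lemma isGood_of_eq_four_mul {N x u v : ℤ} (h3 : N % 3 = 1) (h5 : N % 5 = 1) (h8 : N % 8 = 7)
    (hx : x % 2 = 1) (h : N = 15 * x ^ 2 + 4 * (u ^ 2 + u * v + 4 * v ^ 2)) : IsGood N :=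
  isGood_of_parity (s := 2 * u + v) (a := x) (b := v) h3 h5 h8 (by rw [h]; ring) hx (by omega)

lemma isGood_of_eq {N x u v : ℤ} (h3 : N % 3 = 1) (h5 : N % 5 = 1) (h8 : N % 8 = 7)
    (h : N = 15 * x ^ 2 + u ^ 2 + u * v + 4 * v ^ 2) : IsGood N := by
  rcases Int.even_or_odd' x with ⟨k, rfl | rfl⟩
  · rcases Int.even_or_odd' u with ⟨w, rfl | rfl⟩
    · have : N = 2 * (30 * k ^ 2 + 2 * w ^ 2 + w * v + 2 * v ^ 2) := by rw [h]; ring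
      omega
    rcases Int.even_or_odd' v with ⟨t, rfl | rfl⟩
    · have : N = 4 * (15 * k ^ 2 + w ^ 2 + w + w * t + 4 * t ^ 2) + 2 * t + 1 := by
        rw [h]; ring
      exact isGood_of_parity (s := 2 * w + 1 + t) (a := t) (b := 2 * k) h3 h5 h8
        (by rw [h]; ring) (by omega) (by omega)
    · have : N = 2 * (30 * k ^ 2 + 2 * w ^ 2 + 3 * w + 2 * w * t + 8 * t ^ 2 + 9 * t + 3) := by
        rw [h]; ring
      omega
  obtain ⟨q, hq⟩ : ∃ q, k * (k + 1) = 2 * q := (Int.even_mul_succ_self k).two_dvd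
  have hQ : N = 120 * q + 15 + (u * (u + v) + 4 * v ^ 2) := by
    rw [h]; linear_combination 60 * hq
  rcases Int.even_or_odd' v with ⟨t, rfl | rfl⟩
  · rcases Int.even_or_odd' u with ⟨w, rfl | rfl⟩
    · exact isGood_of_eq_four_mul (x := 2 * k + 1) (u := w) (v := t) h3 h5 h8 (by omega)
        (by rw [h]; ring)
    · have : (2 * w + 1) * (2 * w + 1 + 2 * t) + 4 * (2 * t) ^ 2 =
          2 * (2 * w ^ 2 + 2 * w + 2 * w * t + t + 8 * t ^ 2) + 1 := by ring
      omega
  · have h4 : (4 : ℤ) ∣ u * (u + (2 * t + 1)) := by omega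
    rcases Int.even_or_odd u with hu | hu
    · have : IsCoprime (4 : ℤ) (u + (2 * t + 1)) := by
        have : Odd (u + (2 * t + 1)) := hu.add_odd (odd_two_mul_add_one t)
        exact IsCoprime.pow_left (m := 2) (Int.isCoprime_two_left.2 this)
      obtain ⟨w, rfl⟩ := this.dvd_of_dvd_mul_right h4
      exact isGood_of_eq_four_mul (x := 2 * k + 1) (u := 2 * t + 1) (v := w) h3 h5 h8 (by omega)
        (by rw [h]; ring)
    · have : IsCoprime (4 : ℤ) u :=
        IsCoprime.pow_left (m := 2) (Int.isCoprime_two_left.2 hu)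
      obtain ⟨w, hw⟩ := this.dvd_of_dvd_mul_left h4
      obtain rfl : u = 4 * w - (2 * t + 1) := by linarith
      exact isGood_of_eq_four_mul (x := 2 * k + 1) (u := -(2 * t + 1)) (v := w) h3 h5 h8
        (by omega) (by rw [h]; ring)

lemma isGood_of_dvd_sub {N m y z : ℤ} (h3 : N % 3 = 1) (h5 : N % 5 = 1) (h8 : N % 8 = 7)
    (h : N = 3 * m ^ 2 + y ^ 2 + y * z + z ^ 2) (hm : (5 : ℤ) ∣ m - z) : IsGood N := by
  obtain ⟨x, hx⟩ := hm
  obtain rfl : m = z + 5 * x := by linarith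
  exact isGood_of_eq (x := x) (u := y - 2 * x) (v := z + 4 * x) h3 h5 h8 (by rw [h]; ring)

lemma isGood {N : ℤ} (hN : 0 < N) (h3 : N % 3 = 1) (h5 : N % 5 = 1) (h8 : N % 8 = 7) :
    IsGood N := by
  obtain ⟨m, y, z, h⟩ := exists_eq_three_mul_sq_add hN h8 h3
  have key : (5 : ℤ) ∣ m - z ∨ (5 : ℤ) ∣ -m - z ∨ (5 : ℤ) ∣ m - y ∨ (5 : ℤ) ∣ -m - y ∨
      (5 : ℤ) ∣ m - (y + z) ∨ (5 : ℤ) ∣ -m - (y + z) := by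
    have h1 : ((3 * m ^ 2 + y ^ 2 + y * z + z ^ 2 - 1 : ℤ) : ZMod 5) = 0 :=
      (ZMod.intCast_zmod_eq_zero_iff_dvd _ 5).2 (by rw [← h]; omega)
    have h0 (x : ℤ) : (5 : ℤ) ∣ x ↔ (x : ZMod 5) = 0 :=
      (ZMod.intCast_zmod_eq_zero_iff_dvd x 5).symm
    simp only [h0]
    push_cast at h1 ⊢
    generalize (m : ZMod 5) = m at *
    generalize (y : ZMod 5) = y at *
    generalize (z : ZMod 5) = z at *
    clear h
    revert m y z
    decide
  rcases key with hd | hd | hd | hd | hd | hd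
  · exact isGood_of_dvd_sub h3 h5 h8 h hd
  · exact isGood_of_dvd_sub (y := y) h3 h5 h8 (by rw [h]; ring) hd
  · exact isGood_of_dvd_sub (y := z) h3 h5 h8 (by rw [h]; ring) hd
  · exact isGood_of_dvd_sub (y := z) h3 h5 h8 (by rw [h]; ring) hd
  · exact isGood_of_dvd_sub (y := -z) h3 h5 h8 (by rw [h]; ring) hd
  · exact isGood_of_dvd_sub (y := -z) h3 h5 h8 (by rw [h]; ring) hd

lemma exists_not_both_even {u v : ℤ} (h : u ≠ 0 ∨ v ≠ 0) :
    ∃ u' v' : ℤ, u' ^ 2 + u' * v' + 4 * v' ^ 2 = u ^ 2 + u * v + 4 * v ^ 2 ∧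
      (u' % 2 = 1 ∨ v' % 2 = 1) := by
  induction hn : u.natAbs + v.natAbs using Nat.strong_induction_on generalizing u v with
  | _ n ih =>
    by_cases huv : u % 2 = 1 ∨ v % 2 = 1
    · exact ⟨u, v, rfl, huv⟩
    obtain ⟨u, rfl⟩ : ∃ k, u = 2 * k := ⟨u / 2, by omega⟩
    obtain ⟨v, rfl⟩ : ∃ k, v = 2 * k := ⟨v / 2, by omega⟩
    obtain ⟨u', v', he, ho⟩ := ih (u.natAbs + v.natAbs) (by omega) (by omega) rfl
    by_cases hu : u' % 2 = 1
    · exact ⟨u' + 4 * v', -u', by linear_combination 4 * he, by omega⟩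
    · exact ⟨-4 * v', u' + v', by linear_combination 4 * he, by omega⟩

lemma exists_odd {u v : ℤ} (h : u ≠ 0 ∨ v ≠ 0) :
    ∃ u' v' : ℤ, u' ^ 2 + u' * v' + 4 * v' ^ 2 = u ^ 2 + u * v + 4 * v ^ 2 ∧ u' % 2 = 1 := by
  obtain ⟨u', v', he, ho⟩ := exists_not_both_even h
  by_cases hu : u' % 2 = 1
  · exact ⟨u', v', he, hu⟩
  · exact ⟨u' + v', -v', by linear_combination he, by omega⟩

lemma exists_of_isGood {n : ℤ} (h : IsGood (120 * n + 31)) :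
    ∃ x y z : ℤ, x * (2 * x + 1) + y * (3 * y + 1) + z * (5 * z + 1) = n := by
  obtain ⟨X, u, v, hX⟩ := h
  have h0 : u ≠ 0 ∨ v ≠ 0 := by
    by_contra! h0
    rw [h0.1, h0.2] at hX
    omega
  obtain ⟨u, v, he, ho⟩ := exists_odd h0
  have hN : 15 * X ^ 2 + 10 * (u + 2 * v) ^ 2 + 6 * (u - 2 * v) ^ 2 = 120 * n + 31 := by
    rw [hX]; linear_combination 16 * he
  have hY2 : (u + 2 * v) % 2 = 1 := by omega
  have hZ2 : (u - 2 * v) % 2 = 1 := by omega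
  generalize u + 2 * v = Y at hN hY2
  generalize u - 2 * v = Z at hN hZ2
  clear hX he ho h0
  have hX2 : X % 2 = 1 := by
    by_contra h
    obtain ⟨k, rfl⟩ : ∃ k, X = 2 * k := ⟨X / 2, by omega⟩
    have : 15 * (2 * k) ^ 2 + 10 * Y ^ 2 + 6 * Z ^ 2 =
      2 * (30 * k ^ 2 + 5 * Y ^ 2 + 3 * Z ^ 2) := by ring
    omega
  have hY3 : Y % 3 ≠ 0 := by
    intro h
    obtain ⟨k, rfl⟩ : ∃ k, Y = 3 * k := ⟨Y / 3, by omega⟩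
    have : 15 * X ^ 2 + 10 * (3 * k) ^ 2 + 6 * Z ^ 2 =
      3 * (5 * X ^ 2 + 30 * k ^ 2 + 2 * Z ^ 2) := by ring
    omega
  have hZ5 : Z % 5 = 1 ∨ Z % 5 = 4 := by
    obtain ⟨k, r, hr, rfl⟩ : ∃ k r, (0 ≤ r ∧ r < 5) ∧ Z = 5 * k + r :=
      ⟨Z / 5, Z % 5, by omega, by omega⟩
    have : 15 * X ^ 2 + 10 * Y ^ 2 + 6 * (5 * k + r) ^ 2 =
      5 * (3 * X ^ 2 + 2 * Y ^ 2 + 30 * k ^ 2 + 12 * k * r) + 6 * r ^ 2 := by ring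
    obtain ⟨h1, h2⟩ := hr
    interval_cases r <;> omega
  obtain ⟨x, hx⟩ : ∃ x, X = 4 * x + 1 ∨ X = -(4 * x + 1) := by
    rcases (by omega : X % 4 = 1 ∨ X % 4 = 3) with h | h
    · exact ⟨X / 4, by omega⟩
    · exact ⟨-X / 4, by omega⟩
  obtain ⟨y, hy⟩ : ∃ y, Y = 6 * y + 1 ∨ Y = -(6 * y + 1) := by
    rcases (by omega : Y % 6 = 1 ∨ Y % 6 = 5) with h | h
    · exact ⟨Y / 6, by omega⟩
    · exact ⟨-Y / 6, by omega⟩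
  obtain ⟨z, hz⟩ : ∃ z, Z = 10 * z + 1 ∨ Z = -(10 * z + 1) := by
    rcases (by omega : Z % 10 = 1 ∨ Z % 10 = 9) with h | h
    · exact ⟨Z / 10, by omega⟩
    · exact ⟨-Z / 10, by omega⟩
  have hx' : X ^ 2 = (4 * x + 1) ^ 2 := sq_eq_sq_iff_eq_or_eq_neg.2 hx
  have hy' : Y ^ 2 = (6 * y + 1) ^ 2 := sq_eq_sq_iff_eq_or_eq_neg.2 hy
  have hz' : Z ^ 2 = (10 * z + 1) ^ 2 := sq_eq_sq_iff_eq_or_eq_neg.2 hz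
  rw [hx', hy', hz'] at hN
  exact ⟨x, y, z, by linarith⟩

/-- The ternary sum `x(2x+1) + y(3y+1) + z(5z+1)` is universal: for every
non negative integer `n`, the equation `x(2x+1) + y(3y+1) + z(5z+1) = n`
has an integer solution `x, y, z`. -/
theorem universal_2_3_5 (n : ℤ) (hn : 0 ≤ n) :
    ∃ x y z : ℤ, x * (2 * x + 1) + y * (3 * y + 1) + z * (5 * z + 1) = n := by
  exact exists_of_isGood (isGood (by omega) (by omega) (by omega) (by omega))
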